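/- F(x) · e^{x} / √x tends to √(π/2) as x → ∞. -/

import Mathlib

open Filter

/-- The modified Bessel function of the second kind, for ν > −1/2 and x > 0. -/
noncomputable def besselK (ν x : ℝ) : ℝ :=
  (Real.sqrt Real.pi / Real.Gamma (ν + 1/2)) * (x/2) ^ ν *
    ∫ t in Set.Ioi (1:ℝ), Real.exp (-x * t) * (t^2 - 1) ^ (ν - 1/2)

/-- The synchrotron function F(x) = x ∫_x^∞ K_{5/3}(t) dt. -/
noncomputable def synchrotronF (x : ℝ) : ℝ :=
  x * ∫ t in Set.Ioi x, besselK (5/3) t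

open MeasureTheory Set Real Topology

lemma setIntegral_Ioi_eq_add_left (f : ℝ → ℝ) (c : ℝ) :
    ∫ t in Ioi c, f t = ∫ s in Ioi (0:ℝ), f (c + s) := by
  have h := (measurePreserving_add_left volume c).setIntegral_preimage_emb
    (measurableEmbedding_addLeft c) f (Ioi c)
  rw [← h]
  simp

lemma measurable_besselK (ν : ℝ) : Measurable (besselK ν) := by
  have h : StronglyMeasurable (Function.uncurry fun x t : ℝ =>
      exp (-x * t) * (t^2 - 1) ^ (ν - 1/2)) := by
    apply Measurable.stronglyMeasurable
    unfold Function.uncurry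
    fun_prop
  have h' := (h.integral_prod_right (ν := volume.restrict (Ioi (1:ℝ)))).measurable
  unfold besselK
  exact (by fun_prop : Measurable fun x : ℝ =>
    (√π / Gamma (ν + 1/2)) * (x/2) ^ ν).mul h'

/-- Rescaling `t = 1 + u / x` in the defining integral of `besselK`. -/
lemma setIntegral_exp_mul_sq_sub_one_rpow (a : ℝ) {x : ℝ} (hx : 0 < x) :
    ∫ t in Ioi (1:ℝ), exp (-x * t) * (t^2 - 1) ^ a =
      exp (-x) * x ^ (-(a + 1)) *
        ∫ u in Ioi (0:ℝ), exp (-u) * u ^ a * (2 + u / x) ^ a := by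
  rw [setIntegral_Ioi_eq_add_left]
  have h := integral_comp_mul_left_Ioi
    (fun s : ℝ => exp (-x * (1 + s)) * ((1 + s)^2 - 1) ^ a) 0 (inv_pos.mpr hx)
  rw [mul_zero, inv_inv, smul_eq_mul] at h
  rw [← mul_right_inj' hx.ne', ← h, ← mul_assoc, ← integral_const_mul]
  refine setIntegral_congr_fun measurableSet_Ioi fun u hu => ?_
  have hu : 0 < u := hu
  have e1 : (1 + x⁻¹ * u)^2 - 1 = x⁻¹ * (u * (2 + u / x)) := by
    field_simp
    ring
  have e2 : -x * (1 + x⁻¹ * u) = -x + -u := by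
    field_simp
    ring
  have e3 : x ^ (-(a + 1)) = x⁻¹ ^ a * x⁻¹ := by
    rw [rpow_neg hx.le, ← inv_rpow hx.le, rpow_add_one (by positivity)]
  rw [e1, e2, e3, exp_add, mul_rpow (by positivity) (by positivity),
    mul_rpow hu.le (by positivity)]
  field_simp

lemma tendsto_setIntegral_exp_neg_mul_rpow {a : ℝ} (ha : 0 ≤ a) :
    Tendsto (fun x : ℝ => ∫ u in Ioi (0:ℝ), exp (-u) * u ^ a * (2 + u / x) ^ a)
      atTop (𝓝 (Gamma (a + 1) * 2 ^ a)) := by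
  have hΓ : Gamma (a + 1) * 2 ^ a = ∫ u in Ioi (0:ℝ), exp (-u) * u ^ a * 2 ^ a := by
    rw [integral_mul_const, Gamma_eq_integral (by linarith), add_sub_cancel_right]
  rw [hΓ]
  refine tendsto_integral_filter_of_dominated_convergence
    (fun u => exp (-u) * u ^ a * 4 ^ a + exp (-u) * u ^ (2 * a) * 2 ^ a) ?_ ?_ ?_ ?_
  · refine Eventually.of_forall fun x => Measurable.aestronglyMeasurable ?_
    fun_prop
  · filter_upwards [eventually_ge_atTop 1] with x hx
    refine (ae_restrict_iff' measurableSet_Ioi).mpr (Eventually.of_forall fun u hu => ?_)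
    have hu : 0 < u := hu
    have hux : u / x ≤ u := div_le_self hu.le hx
    have hux0 : 0 ≤ u / x := by positivity
    rw [norm_of_nonneg (by positivity)]
    have key : (2 + u / x) ^ a ≤ 4 ^ a + u ^ a * 2 ^ a := by
      rcases le_total u 2 with h | h
      · have := rpow_le_rpow (by positivity) (by linarith : 2 + u / x ≤ 4) ha
        have : 0 ≤ u ^ a * 2 ^ a := by positivity
        linarith
      · have := rpow_le_rpow (by positivity) (by linarith : 2 + u / x ≤ u * 2) ha
        rw [mul_rpow hu.le (by norm_num)] at this
        have : (0:ℝ) ≤ 4 ^ a := by positivity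
        linarith
    calc exp (-u) * u ^ a * (2 + u / x) ^ a
        ≤ exp (-u) * u ^ a * (4 ^ a + u ^ a * 2 ^ a) := by gcongr
      _ = _ := by rw [two_mul a, rpow_add hu]; ring
  · have h1 := GammaIntegral_convergent (by linarith : 0 < a + 1)
    have h2 := GammaIntegral_convergent (by linarith : 0 < 2 * a + 1)
    rw [add_sub_cancel_right] at h1 h2
    exact (h1.mul_const _).add (h2.mul_const _)
  · refine Eventually.of_forall fun u => ?_
    have h : Tendsto (fun x : ℝ => 2 + u / x) atTop (𝓝 2) := by
      simpa using (tendsto_const_nhds (x := (2:ℝ))).add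
        ((tendsto_const_nhds (x := u)).div_atTop tendsto_id)
    exact (h.rpow_const (Or.inl two_ne_zero)).const_mul _

/-- The leading large-argument asymptotics of `besselK`. -/
lemma tendsto_besselK_mul_exp_mul_sqrt {ν : ℝ} (hν : 1 / 2 ≤ ν) :
    Tendsto (fun x : ℝ => besselK ν x * exp x * √x) atTop (𝓝 √(π / 2)) := by
  have hΓ : 0 < Gamma (ν + 1/2) := Gamma_pos_of_pos (by linarith)
  have h := (tendsto_setIntegral_exp_neg_mul_rpow (sub_nonneg.mpr hν)).const_mul
    (√π / Gamma (ν + 1/2) * (2 ^ ν)⁻¹)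
  have hlim : √π / Gamma (ν + 1/2) * (2 ^ ν)⁻¹ * (Gamma (ν - 1/2 + 1) * 2 ^ (ν - 1/2))
      = √(π / 2) := by
    rw [show ν - 1/2 + 1 = ν + 1/2 by ring, rpow_sub two_pos, ← sqrt_eq_rpow,
      sqrt_div pi_pos.le]
    field_simp
  rw [hlim] at h
  refine h.congr' ?_
  filter_upwards [eventually_gt_atTop 0] with x hx
  have hpow : x ^ ν * x ^ (-(ν - 1/2 + 1)) * √x = 1 := by
    rw [sqrt_eq_rpow, ← rpow_add hx, ← rpow_add hx,
      show ν + -(ν - 1/2 + 1) + 1/2 = 0 by ring, rpow_zero]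
  have hexp : exp (-x) * exp x = 1 := by rw [← exp_add]; simp
  rw [besselK, setIntegral_exp_mul_sq_sub_one_rpow _ hx, div_rpow hx.le two_pos.le]
  set I := ∫ u in Ioi (0:ℝ), exp (-u) * u ^ (ν - 1/2) * (2 + u / x) ^ (ν - 1/2)
  calc √π / Gamma (ν + 1/2) * (2 ^ ν)⁻¹ * I
      = √π / Gamma (ν + 1/2) * (2 ^ ν)⁻¹ * I * (x ^ ν * x ^ (-(ν - 1/2 + 1)) * √x) *
          (exp (-x) * exp x) := by rw [hpow, hexp]; ring
    _ = _ := by ring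

/-- The tail integral of a function asymptotic to `L e⁻ˣ / √x` has the same asymptotics. -/
lemma tendsto_sqrt_mul_exp_mul_setIntegral_Ioi {f : ℝ → ℝ} (hf : Measurable f) {L : ℝ}
    (h : Tendsto (fun x : ℝ => f x * exp x * √x) atTop (𝓝 L)) :
    Tendsto (fun x : ℝ => √x * exp x * ∫ t in Ioi x, f t) atTop (𝓝 L) := by
  have hL : L = ∫ s in Ioi (0:ℝ), exp (-s) * L := by
    rw [integral_mul_const, integral_exp_neg_Ioi_zero, one_mul]
  have hbd : ∀ᶠ x in atTop, ‖f x * exp x * √x‖ ≤ ‖L‖ + 1 :=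
    h.norm.eventually_le_const (lt_add_one _)
  obtain ⟨M, hM⟩ := eventually_atTop.mp hbd
  have key : Tendsto (fun x : ℝ => ∫ s in Ioi (0:ℝ), √x * exp x * f (x + s)) atTop
      (𝓝 (∫ s in Ioi (0:ℝ), exp (-s) * L)) := by
    have hrw : ∀ x s : ℝ, 0 < x → 0 < s → √x * exp x * f (x + s) =
        exp (-s) * (√(x / (x + s)) * (f (x + s) * exp (x + s) * √(x + s))) := by
      intro x s hx hs
      have : √(x + s) ≠ 0 := by positivity
      rw [sqrt_div hx.le, exp_add, exp_neg]
      field_simp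
    refine tendsto_integral_filter_of_dominated_convergence
      (fun s => exp (-s) * (‖L‖ + 1)) ?_ ?_ ?_ ?_
    · refine Eventually.of_forall fun x => Measurable.aestronglyMeasurable ?_
      fun_prop
    · filter_upwards [eventually_gt_atTop 0, eventually_ge_atTop M] with x hx hxM
      refine (ae_restrict_iff' measurableSet_Ioi).mpr (Eventually.of_forall fun s hs => ?_)
      have hs : 0 < s := hs
      rw [hrw x s hx hs, norm_mul, norm_mul, norm_of_nonneg (exp_pos _).le,
        norm_of_nonneg (sqrt_nonneg _)]
      have h1 : √(x / (x + s)) ≤ 1 := by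
        rw [sqrt_le_one, div_le_one (by positivity)]
        linarith
      have h2 := hM (x + s) (by linarith)
      gcongr
      calc _ ≤ 1 * (‖L‖ + 1) := by gcongr
        _ = _ := one_mul _
    · exact (integrableOn_exp_neg_Ioi 0).mul_const _
    · refine (ae_restrict_iff' measurableSet_Ioi).mpr (Eventually.of_forall fun s hs => ?_)
      have hadd : Tendsto (fun x : ℝ => x + s) atTop atTop :=
        tendsto_atTop_add_const_right _ _ tendsto_id
      have hratio : Tendsto (fun x : ℝ => x / (x + s)) atTop (𝓝 1) := by
        have h0 : Tendsto (fun x : ℝ => 1 - s / (x + s)) atTop (𝓝 (1 - 0)) :=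
          tendsto_const_nhds.sub (tendsto_const_nhds.div_atTop hadd)
        rw [sub_zero] at h0
        refine h0.congr' ?_
        filter_upwards [eventually_gt_atTop 0] with x hx
        have hs : 0 < s := hs
        field_simp
        ring
      have hsqrt := (hratio.sqrt.mul (h.comp hadd)).const_mul (exp (-s))
      rw [sqrt_one, one_mul] at hsqrt
      refine hsqrt.congr' ?_
      filter_upwards [eventually_gt_atTop 0] with x hx
      exact (hrw x s hx hs).symm
  rw [← hL] at key
  refine key.congr fun x => ?_
  rw [integral_const_mul, ← setIntegral_Ioi_eq_add_left]

/-- F(x) · e^{x} / √x tends to √(π/2) as x → ∞. -/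
theorem synchrotronF_leading_large_x :
    Tendsto (fun x : ℝ => synchrotronF x * Real.exp x / Real.sqrt x)
      atTop (nhds (Real.sqrt (Real.pi / 2))) := by
  refine (tendsto_sqrt_mul_exp_mul_setIntegral_Ioi (measurable_besselK (5/3))
    (tendsto_besselK_mul_exp_mul_sqrt (by norm_num))).congr' ?_
  filter_upwards [eventually_gt_atTop 0] with x hx
  have hsq : √x ≠ 0 := by positivity
  rw [synchrotronF, eq_div_iff hsq]
  linear_combination (exp x * ∫ t in Ioi x, besselK (5/3) t) * mul_self_sqrt hx.le
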